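/- In a location-family random utility model on m alternatives with measurable log-concave probability densities f_1,…,f_m, for any data D = (π^1,…,π^n), the set S_D = {θ ∈ ℝ^m : θ_1 = 0 and l(θ;D) ≥ l(θ′;D) for all θ′ ∈ ℝ^m with θ′_1 = 0} of global maximizers of the log-likelihood on the hyperplane {θ_1 = 0} is a convex subset of ℝ^m. Moreover, if every θ ∈ S_D has pairwise distinct coordinates, then all elements of S_D induce the same strict order on the alternatives: for all θ, θ′ ∈ S_D and all j, j′, θ_j > θ_{j′} if and only if θ′_j > θ′_{j′}. -/

import Mathlib

open MeasureTheory

/-- The probability that the ranking `π` is realized in a location-family random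
utility model with noise densities `f j` and location parameters `θ j`. -/
noncomputable def rumProb {m : ℕ} (f : Fin m → ℝ → ℝ) (θ : Fin m → ℝ)
    (π : Equiv.Perm (Fin m)) : ℝ :=
  ∫ x in {x : Fin m → ℝ | ∀ k l : Fin m, k < l → x (π l) < x (π k)},
    ∏ j, f j (x j - θ j)

/-- The log-likelihood of data `D` of rankings, valued in the extended reals
(so that rankings of probability `0` contribute `⊥ = −∞`). -/
noncomputable def logLik {m n : ℕ} (f : Fin m → ℝ → ℝ)
    (D : Fin n → Equiv.Perm (Fin m)) (θ : Fin m → ℝ) : EReal :=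
  ∑ i, ENNReal.log (ENNReal.ofReal (rumProb f θ (D i)))

/-- The set of global maximizers of the log-likelihood on the hyperplane where the
parameter of the first alternative is fixed to `0`. -/
noncomputable def maxSet {m n : ℕ} (hm : 0 < m) (f : Fin m → ℝ → ℝ)
    (D : Fin n → Equiv.Perm (Fin m)) : Set (Fin m → ℝ) :=
  {θ | θ ⟨0, hm⟩ = 0 ∧
    ∀ θ' : Fin m → ℝ, θ' ⟨0, hm⟩ = 0 → logLik f D θ' ≤ logLik f D θ}

/-- One-dimensional Brunn–Minkowski inequality. -/
lemma volume_add_volume_le_of_add_mem {A B C : Set ℝ} (hA : MeasurableSet A)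
    (hB : MeasurableSet B) (hA' : A.Nonempty) (hB' : B.Nonempty)
    (h : ∀ x ∈ A, ∀ y ∈ B, x + y ∈ C) : volume A + volume B ≤ volume C := by
  by_cases hA0 : volume A = 0
  · obtain ⟨x, hx⟩ := hA'
    rw [hA0, zero_add, ← measure_preimage_add volume (-x) B]
    exact measure_mono fun y hy => by simpa using h x hx _ hy
  by_cases hB0 : volume B = 0
  · obtain ⟨y, hy⟩ := hB'
    rw [hB0, add_zero, ← measure_preimage_add volume (-y) A]
    exact measure_mono fun x hx => by simpa [add_comm, add_left_comm] using h _ hx y hy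
  refine le_of_forall_lt fun r hr => ?_
  obtain ⟨r₁, hr₁, r₂, hr₂, hlt⟩ := ENNReal.exists_lt_add_of_lt_add hr hA0 hB0
  obtain ⟨K, hKA, hK, hrK⟩ := hA.exists_lt_isCompact hr₁
  obtain ⟨L, hLB, hL, hrL⟩ := hB.exists_lt_isCompact hr₂
  have hKne : K.Nonempty := nonempty_of_measure_ne_zero (ne_bot_of_gt hrK)
  have hLne : L.Nonempty := nonempty_of_measure_ne_zero (ne_bot_of_gt hrL)
  obtain ⟨k, hk⟩ := hK.exists_isGreatest hKne
  obtain ⟨l, hl⟩ := hL.exists_isLeast hLne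
  refine hlt.trans_le ((add_le_add hrK.le hrL.le).trans ?_)
  rw [← measure_preimage_add volume (-l) K, ← measure_preimage_add volume (-k) L,
    ← measure_union₀]
  · refine measure_mono ?_
    rintro z (hz | hz)
    · simpa using h _ (hKA hz) l (hLB hl.1)
    · simpa using h k (hKA hk.1) _ (hLB hz)
  · exact (hL.measurableSet.preimage (measurable_const_add _)).nullMeasurableSet
  · refine measure_mono_null (t := {k + l}) ?_ (by simp)
    rintro z ⟨hz₁, hz₂⟩
    have h₁ := hk.2 hz₁
    have h₂ := hl.2 hz₂
    simp only [Set.mem_singleton_iff]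
    linarith

lemma ENNReal.rpow_mul_rpow_le_ofReal_mul_add {a b : ℝ} (ha : 0 < a) (hb : 0 < b)
    (hab : a + b = 1) (x y : ENNReal) :
    x ^ a * y ^ b ≤ ENNReal.ofReal a * x + ENNReal.ofReal b * y := by
  by_cases hx : x = ⊤
  · simp [hx, ENNReal.mul_top, ha]
  by_cases hy : y = ⊤
  · simp [hy, ENNReal.mul_top, hb]
  rw [← ENNReal.ofReal_toReal hx, ← ENNReal.ofReal_toReal hy,
    ENNReal.ofReal_rpow_of_nonneg ENNReal.toReal_nonneg ha.le,
    ENNReal.ofReal_rpow_of_nonneg ENNReal.toReal_nonneg hb.le,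
    ← ENNReal.ofReal_mul (by positivity), ← ENNReal.ofReal_mul ha.le, ← ENNReal.ofReal_mul hb.le,
    ← ENNReal.ofReal_add (by positivity) (by positivity)]
  exact ENNReal.ofReal_le_ofReal (Real.geom_mean_le_arith_mean2_weighted ha.le hb.le
    ENNReal.toReal_nonneg ENNReal.toReal_nonneg hab)

lemma lintegral_eq_lintegral_meas_ofReal_lt {α : Type*} [MeasurableSpace α] (μ : Measure α)
    {u : α → ENNReal} (hu : Measurable u) (hu1 : ∀ x, u x ≠ ⊤) :
    ∫⁻ x, u x ∂μ = ∫⁻ t in Set.Ioi (0 : ℝ), μ {x | ENNReal.ofReal t < u x} := by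
  have h := lintegral_eq_lintegral_meas_lt μ (f := fun x => (u x).toReal)
    (Filter.Eventually.of_forall fun x => ENNReal.toReal_nonneg) hu.ennreal_toReal.aemeasurable
  simp only [ENNReal.ofReal_toReal (hu1 _)] at h
  rw [h]
  refine setLIntegral_congr_fun measurableSet_Ioi fun t ht => ?_
  simp only [ENNReal.ofReal_lt_iff_lt_toReal (le_of_lt ht) (hu1 _)]

open scoped Pointwise in
/-- Prékopa–Leindler on the line in arithmetic-mean form, for functions with supremum `1`. -/
lemma ofReal_mul_lintegral_add_le_of_rpow_mul_rpow_le {a b : ℝ} (ha : 0 < a) (hb : 0 < b)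
    (hab : a + b = 1) {u v w : ℝ → ENNReal} (hu : Measurable u) (hv : Measurable v)
    (hw : Measurable w) (hu1 : ∀ x, u x ≤ 1) (hv1 : ∀ x, v x ≤ 1)
    (hus : ∀ r < 1, ∃ x, r < u x) (hvs : ∀ r < 1, ∃ x, r < v x)
    (h : ∀ x y, u x ^ a * v y ^ b ≤ w (a * x + b * y)) :
    ENNReal.ofReal a * (∫⁻ x, u x) + ENNReal.ofReal b * (∫⁻ x, v x) ≤ ∫⁻ x, w x := by
  have hw' : ∫⁻ x, min (w x) 1 ≤ ∫⁻ x, w x := lintegral_mono fun x => min_le_left _ _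
  refine le_trans ?_ hw'
  rw [lintegral_eq_lintegral_meas_ofReal_lt volume hu
      fun x => ((hu1 x).trans_lt ENNReal.one_lt_top).ne,
    lintegral_eq_lintegral_meas_ofReal_lt volume hv
      fun x => ((hv1 x).trans_lt ENNReal.one_lt_top).ne,
    lintegral_eq_lintegral_meas_ofReal_lt volume (hw.min measurable_const)
      fun x => ((min_le_right _ _).trans_lt ENNReal.one_lt_top).ne,
    ← lintegral_const_mul' _ _ ENNReal.ofReal_ne_top,
    ← lintegral_const_mul' _ _ ENNReal.ofReal_ne_top]
  refine (le_lintegral_add _ _).trans (setLIntegral_mono' measurableSet_Ioi fun t ht => ?_)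
  rcases le_or_gt 1 t with h1 | h1
  · have h1' : 1 ≤ ENNReal.ofReal t := by simpa using h1
    have e₁ : {x | ENNReal.ofReal t < u x} = ∅ :=
      Set.eq_empty_of_forall_notMem fun x hx => absurd (hx.trans_le (hu1 x)) h1'.not_gt
    have e₂ : {x | ENNReal.ofReal t < v x} = ∅ :=
      Set.eq_empty_of_forall_notMem fun x hx => absurd (hx.trans_le (hv1 x)) h1'.not_gt
    simp [e₁, e₂]
  have ht1 : ENNReal.ofReal t < 1 := by simpa using h1
  have hsmul : ∀ (c : ℝ), 0 < c → ∀ s : Set ℝ,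
      ENNReal.ofReal c * volume s = volume (c • s) := fun c hc s => by
    rw [Measure.addHaar_smul]; simp [abs_of_pos hc]
  simp only [hsmul a ha, hsmul b hb]
  refine volume_add_volume_le_of_add_mem
    ((measurableSet_lt measurable_const hu).const_smul₀ a)
    ((measurableSet_lt measurable_const hv).const_smul₀ b)
    (Set.Nonempty.smul_set (hus _ ht1)) (Set.Nonempty.smul_set (hvs _ ht1)) ?_
  rintro _ ⟨x, hx, rfl⟩ _ ⟨y, hy, rfl⟩
  refine lt_min (lt_of_lt_of_le ?_ (h x y)) ht1
  calc ENNReal.ofReal t = ENNReal.ofReal t ^ a * ENNReal.ofReal t ^ b := by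
        rw [← ENNReal.rpow_add_of_nonneg _ _ ha.le hb.le, hab, ENNReal.rpow_one]
    _ < _ := ENNReal.mul_lt_mul (ENNReal.rpow_lt_rpow hx ha) (ENNReal.rpow_lt_rpow hy hb)

lemma ENNReal.exists_lt_div_iSup {ι : Type*} {u : ι → ENNReal} (h0 : ⨆ i, u i ≠ 0)
    (htop : ⨆ i, u i ≠ ⊤) {r : ENNReal} (hr : r < 1) : ∃ i, r < u i / ⨆ j, u j := by
  have : r * (⨆ i, u i) < ⨆ i, u i := by
    simpa using ENNReal.mul_lt_mul_left h0 htop hr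
  obtain ⟨i, hi⟩ := lt_iSup_iff.1 this
  exact ⟨i, (ENNReal.lt_div_iff_mul_lt (Or.inl h0) (Or.inl htop)).2 hi⟩

lemma lintegral_rpow_mul_le_of_bounded {a b : ℝ} (ha : 0 < a) (hb : 0 < b)
    (hab : a + b = 1) {u v w : ℝ → ENNReal} (hu : Measurable u) (hv : Measurable v)
    (hw : Measurable w) (hut : ⨆ x, u x ≠ ⊤) (hvt : ⨆ x, v x ≠ ⊤)
    (h : ∀ x y, u x ^ a * v y ^ b ≤ w (a * x + b * y)) :
    (∫⁻ x, u x) ^ a * (∫⁻ x, v x) ^ b ≤ ∫⁻ x, w x := by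
  by_cases hu0 : ⨆ x, u x = 0
  · have : ∀ x, u x = 0 := by simpa using hu0
    simp [this, ha]
  by_cases hv0 : ⨆ x, v x = 0
  · have : ∀ x, v x = 0 := by simpa using hv0
    simp [this, hb]
  set A := ⨆ x, u x with hA
  set B := ⨆ x, v x with hB
  have hc0 : A ^ a * B ^ b ≠ 0 := by simp [hu0, hv0, hut, hvt]
  have hct : A ^ a * B ^ b ≠ ⊤ :=
    ENNReal.mul_ne_top (ENNReal.rpow_ne_top_of_nonneg ha.le hut)
      (ENNReal.rpow_ne_top_of_nonneg hb.le hvt)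
  have hdiv : ∀ x y : ENNReal,
      (x / A) ^ a * (y / B) ^ b = x ^ a * y ^ b / (A ^ a * B ^ b) := fun x y => by
    rw [ENNReal.div_rpow_of_nonneg _ _ ha.le, ENNReal.div_rpow_of_nonneg _ _ hb.le]
    simp only [div_eq_mul_inv]
    rw [ENNReal.mul_inv (by simp [hu0, hut]) (by simp [hu0, hut])]
    ring
  have key := ofReal_mul_lintegral_add_le_of_rpow_mul_rpow_le ha hb hab
    (u := fun x => u x / A) (v := fun x => v x / B) (w := fun x => w x / (A ^ a * B ^ b))
    (hu.div_const _) (hv.div_const _) (hw.div_const _)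
    (fun x => ENNReal.div_le_of_le_mul (by simpa using le_iSup u x))
    (fun x => ENNReal.div_le_of_le_mul (by simpa using le_iSup v x))
    (fun r hr => ENNReal.exists_lt_div_iSup hu0 hut hr)
    (fun r hr => ENNReal.exists_lt_div_iSup hv0 hvt hr)
    (fun x y => by rw [hdiv]; exact ENNReal.div_le_div_right (h x y) _)
  replace key := (ENNReal.rpow_mul_rpow_le_ofReal_mul_add ha hb hab _ _).trans key
  simp only [div_eq_mul_inv] at key
  rw [lintegral_mul_const _ hu, lintegral_mul_const _ hv, lintegral_mul_const _ hw] at key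
  simp only [← div_eq_mul_inv] at key
  rw [hdiv] at key
  exact ((ENNReal.div_le_iff hc0 hct).1 key).trans_eq (ENNReal.div_mul_cancel hc0 hct)

lemma lintegral_eq_iSup_lintegral_min {α : Type*} [MeasurableSpace α] (μ : Measure α)
    {u : α → ENNReal} (hu : Measurable u) :
    ∫⁻ x, u x ∂μ = ⨆ n : ℕ, ∫⁻ x, min (u x) n ∂μ := by
  rw [← lintegral_iSup (fun n => hu.min measurable_const)
    (fun m n hmn x => min_le_min_left _ (by exact_mod_cast hmn))]
  congr 1 with x
  rw [← inf_iSup_eq, ENNReal.iSup_natCast, inf_top_eq]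

/-- The one-dimensional Prékopa–Leindler inequality. -/
lemma lintegral_rpow_mul_le {a b : ℝ} (ha : 0 < a) (hb : 0 < b)
    (hab : a + b = 1) {u v w : ℝ → ENNReal} (hu : Measurable u) (hv : Measurable v)
    (hw : Measurable w) (h : ∀ x y, u x ^ a * v y ^ b ≤ w (a * x + b * y)) :
    (∫⁻ x, u x) ^ a * (∫⁻ x, v x) ^ b ≤ ∫⁻ x, w x := by
  have hrpow : ∀ {c : ℝ}, 0 < c → ∀ s : ℕ → ENNReal, (⨆ n, s n) ^ c = ⨆ n, s n ^ c :=
    fun hc s => (ENNReal.orderIsoRpow _ hc).map_iSup s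
  rw [lintegral_eq_iSup_lintegral_min volume hu, lintegral_eq_iSup_lintegral_min volume hv,
    hrpow ha, hrpow hb, ENNReal.iSup_mul]
  simp only [ENNReal.mul_iSup]
  have hmin : ∀ (z : ℝ → ENNReal) (n : ℕ), ⨆ x, min (z x) (n : ENNReal) ≠ ⊤ := fun z n =>
    ((iSup_le fun x => min_le_right _ _).trans_lt (ENNReal.natCast_lt_top n)).ne
  refine iSup_le fun i => iSup_le fun j => lintegral_rpow_mul_le_of_bounded ha hb hab
    (hu.min measurable_const) (hv.min measurable_const) hw (hmin _ _) (hmin _ _)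
    fun x y => (mul_le_mul' ?_ ?_).trans (h x y)
  · exact ENNReal.rpow_le_rpow (min_le_left _ _) ha.le
  · exact ENNReal.rpow_le_rpow (min_le_left _ _) hb.le

lemma lintegral_fin_succ_pi {n : ℕ} {u : (Fin (n + 1) → ℝ) → ENNReal} (hu : Measurable u) :
    ∫⁻ x, u x = ∫⁻ s : ℝ, ∫⁻ y : Fin n → ℝ, u (Fin.cons s y) := by
  have hmp := (volume_preserving_piFinSuccAbove (fun _ : Fin (n + 1) => ℝ) 0).symm
  rw [← hmp.lintegral_comp hu, Measure.volume_eq_prod, lintegral_prod]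
  · simp [MeasurableEquiv.piFinSuccAbove, Fin.consEquiv]
  · exact (hu.comp (MeasurableEquiv.measurable _)).aemeasurable

lemma measurable_fin_cons {n : ℕ} :
    Measurable fun p : ℝ × (Fin n → ℝ) => (Fin.cons p.1 p.2 : Fin (n + 1) → ℝ) := by
  refine measurable_pi_iff.2 fun i => ?_
  refine Fin.cases ?_ (fun j => ?_) i
  · simpa using measurable_fst
  · simpa using measurable_pi_iff.1 measurable_snd j

/-- The Prékopa–Leindler inequality on `ℝⁿ`. -/
theorem lintegral_pi_rpow_mul_le {a b : ℝ} (ha : 0 < a) (hb : 0 < b) (hab : a + b = 1) {n : ℕ}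
    {u v w : (Fin n → ℝ) → ENNReal} (hu : Measurable u) (hv : Measurable v)
    (hw : Measurable w) (h : ∀ x y, u x ^ a * v y ^ b ≤ w (a • x + b • y)) :
    (∫⁻ x, u x) ^ a * (∫⁻ x, v x) ^ b ≤ ∫⁻ x, w x := by
  induction n with
  | zero =>
    have e : (volume : Measure (Fin 0 → ℝ)) Set.univ = 1 := by
      simp [volume_pi]
    rw [lintegral_unique, lintegral_unique, lintegral_unique, e, mul_one, mul_one, mul_one]
    convert h default default
  | succ n ih =>
    rw [lintegral_fin_succ_pi hu, lintegral_fin_succ_pi hv, lintegral_fin_succ_pi hw]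
    refine lintegral_rpow_mul_le ha hb hab
      (hu.comp measurable_fin_cons).lintegral_prod_right'
      (hv.comp measurable_fin_cons).lintegral_prod_right'
      (hw.comp measurable_fin_cons).lintegral_prod_right' fun s t => ?_
    refine ih (hu.comp (measurable_fin_cons.comp measurable_prodMk_left))
      (hv.comp (measurable_fin_cons.comp measurable_prodMk_left))
      (hw.comp (measurable_fin_cons.comp measurable_prodMk_left)) fun x y => ?_
    convert h (Fin.cons s x) (Fin.cons t y) using 2
    ext i
    refine Fin.cases ?_ (fun j => ?_) i <;> simp

lemma measurableSet_ranking {m : ℕ} (π : Equiv.Perm (Fin m)) :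
    MeasurableSet {x : Fin m → ℝ | ∀ k l : Fin m, k < l → x (π l) < x (π k)} := by
  simp only [Set.ofPred_forall]
  exact MeasurableSet.iInter fun k => MeasurableSet.iInter fun l => MeasurableSet.iInter fun _ =>
    measurableSet_lt (measurable_pi_apply _) (measurable_pi_apply _)

/-- The density of a random utility profile, cut off to the region where `π` is realized. -/
noncomputable def rankingDensity {m : ℕ} (f : Fin m → ℝ → ℝ) (θ : Fin m → ℝ)
    (π : Equiv.Perm (Fin m)) : (Fin m → ℝ) → ENNReal :=
  {x : Fin m → ℝ | ∀ k l : Fin m, k < l → x (π l) < x (π k)}.indicator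
    fun x => ENNReal.ofReal (∏ j, f j (x j - θ j))

section LogConcave

variable {m : ℕ} {f : Fin m → ℝ → ℝ}

lemma measurable_rankingDensity (hmeas : ∀ j, Measurable (f j)) (θ : Fin m → ℝ)
    (π : Equiv.Perm (Fin m)) : Measurable (rankingDensity f θ π) := by
  refine Measurable.indicator ?_ (measurableSet_ranking π)
  refine ENNReal.measurable_ofReal.comp (Finset.measurable_fun_prod _ fun j _ => ?_)
  exact (hmeas j).comp ((measurable_pi_apply j).sub_const _)

lemma ofReal_rumProb (hnonneg : ∀ j x, 0 ≤ f j x) (hint : ∀ j, ∫ x, f j x = 1)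
    (θ : Fin m → ℝ) (π : Equiv.Perm (Fin m)) :
    ENNReal.ofReal (rumProb f θ π) = ∫⁻ x, rankingDensity f θ π x := by
  have hi : ∀ j, Integrable (f j) := fun j => by
    by_contra hj
    simpa [integral_undef hj] using hint j
  have hp : Integrable fun x : Fin m → ℝ => ∏ j, f j (x j - θ j) :=
    Integrable.fintype_prod (f := fun j y => f j (y - θ j)) fun j => (hi j).comp_sub_right _
  rw [rumProb, ofReal_integral_eq_lintegral_ofReal hp.integrableOn
    (Filter.Eventually.of_forall fun x => Finset.prod_nonneg fun j _ => hnonneg j _)]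
  exact (lintegral_indicator (measurableSet_ranking π) _).symm

lemma rankingDensity_rpow_mul_le (hnonneg : ∀ j x, 0 ≤ f j x)
    (hlogconcave : ∀ j (x y lam : ℝ), 0 ≤ lam → lam ≤ 1 →
      f j x ^ lam * f j y ^ (1 - lam) ≤ f j (lam * x + (1 - lam) * y))
    {a b : ℝ} (ha : 0 < a) (hb : 0 < b) (hab : a + b = 1) (θ θ' : Fin m → ℝ)
    (π : Equiv.Perm (Fin m)) (x y : Fin m → ℝ) :
    rankingDensity f θ π x ^ a * rankingDensity f θ' π y ^ b ≤
      rankingDensity f (a • θ + b • θ') π (a • x + b • y) := by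
  by_cases hx : ∀ k l : Fin m, k < l → x (π l) < x (π k)
  swap
  · simp [rankingDensity, Set.indicator_of_notMem, hx, ha]
  by_cases hy : ∀ k l : Fin m, k < l → y (π l) < y (π k)
  swap
  · simp [rankingDensity, Set.indicator_of_notMem, hy, hb]
  have hxy : ∀ k l : Fin m, k < l → (a • x + b • y) (π l) < (a • x + b • y) (π k) := by
    intro k l hkl
    simp only [Pi.add_apply, Pi.smul_apply, smul_eq_mul]
    have := mul_lt_mul_of_pos_left (hx k l hkl) ha
    have := mul_lt_mul_of_pos_left (hy k l hkl) hb
    linarith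
  rw [rankingDensity, rankingDensity, rankingDensity, Set.indicator_of_mem (by exact hx),
    Set.indicator_of_mem (by exact hy), Set.indicator_of_mem (by exact hxy),
    ENNReal.ofReal_rpow_of_nonneg (Finset.prod_nonneg fun j _ => hnonneg j _) ha.le,
    ENNReal.ofReal_rpow_of_nonneg (Finset.prod_nonneg fun j _ => hnonneg j _) hb.le,
    ← ENNReal.ofReal_mul (Real.rpow_nonneg (Finset.prod_nonneg fun j _ => hnonneg j _) _),
    ← Real.finsetProd_rpow _ _ fun j _ => hnonneg j _,
    ← Real.finsetProd_rpow _ _ fun j _ => hnonneg j _, ← Finset.prod_mul_distrib]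
  refine ENNReal.ofReal_le_ofReal (Finset.prod_le_prod (fun j _ => ?_) fun j _ => ?_)
  · exact mul_nonneg (Real.rpow_nonneg (hnonneg j _) _) (Real.rpow_nonneg (hnonneg j _) _)
  · have := hlogconcave j (x j - θ j) (y j - θ' j) a ha.le (by linarith)
    rw [show 1 - a = b by linarith] at this
    refine this.trans_eq (congrArg (f j) ?_)
    simp only [Pi.add_apply, Pi.smul_apply, smul_eq_mul]
    ring

lemma ofReal_rumProb_rpow_mul_le (hmeas : ∀ j, Measurable (f j)) (hnonneg : ∀ j x, 0 ≤ f j x)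
    (hint : ∀ j, ∫ x, f j x = 1)
    (hlogconcave : ∀ j (x y lam : ℝ), 0 ≤ lam → lam ≤ 1 →
      f j x ^ lam * f j y ^ (1 - lam) ≤ f j (lam * x + (1 - lam) * y))
    {a b : ℝ} (ha : 0 < a) (hb : 0 < b) (hab : a + b = 1) (θ θ' : Fin m → ℝ)
    (π : Equiv.Perm (Fin m)) :
    ENNReal.ofReal (rumProb f θ π) ^ a * ENNReal.ofReal (rumProb f θ' π) ^ b ≤
      ENNReal.ofReal (rumProb f (a • θ + b • θ') π) := by
  simp only [ofReal_rumProb hnonneg hint]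
  exact lintegral_pi_rpow_mul_le ha hb hab (measurable_rankingDensity hmeas _ _)
    (measurable_rankingDensity hmeas _ _) (measurable_rankingDensity hmeas _ _)
    (rankingDensity_rpow_mul_le hnonneg hlogconcave ha hb hab θ θ' π)

lemma logLik_eq_log_prod {n : ℕ} (D : Fin n → Equiv.Perm (Fin m)) (θ : Fin m → ℝ) :
    logLik f D θ = ENNReal.log (∏ i, ENNReal.ofReal (rumProb f θ (D i))) := by
  rw [logLik]
  induction (Finset.univ : Finset (Fin n)) using Finset.induction_on with
  | empty => simp
  | insert i s hi ih => rw [Finset.sum_insert hi, Finset.prod_insert hi, ENNReal.log_mul_add, ih]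

lemma convex_maxSet (hm : 0 < m) (hmeas : ∀ j, Measurable (f j)) (hnonneg : ∀ j x, 0 ≤ f j x)
    (hint : ∀ j, ∫ x, f j x = 1)
    (hlogconcave : ∀ j (x y lam : ℝ), 0 ≤ lam → lam ≤ 1 →
      f j x ^ lam * f j y ^ (1 - lam) ≤ f j (lam * x + (1 - lam) * y))
    {n : ℕ} (D : Fin n → Equiv.Perm (Fin m)) : Convex ℝ (maxSet hm f D) := by
  refine convex_iff_forall_pos.2 fun θ hθ θ' hθ' a b ha hb hab => ⟨?_, fun η hη => ?_⟩
  · simp [hθ.1, hθ'.1]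
  have h₁ := hθ.2 η hη
  have h₂ := hθ'.2 η hη
  simp only [logLik_eq_log_prod, ENNReal.log_le_log_iff] at h₁ h₂ ⊢
  set M := ∏ i, ENNReal.ofReal (rumProb f η (D i))
  calc M = M ^ a * M ^ b := by
        rw [← ENNReal.rpow_add_of_nonneg _ _ ha.le hb.le, hab, ENNReal.rpow_one]
    _ ≤ _ := mul_le_mul' (ENNReal.rpow_le_rpow h₁ ha.le) (ENNReal.rpow_le_rpow h₂ hb.le)
    _ = ∏ i, (ENNReal.ofReal (rumProb f θ (D i)) ^ a *
          ENNReal.ofReal (rumProb f θ' (D i)) ^ b) := by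
        rw [Finset.prod_mul_distrib, ENNReal.prod_rpow_of_nonneg ha.le,
          ENNReal.prod_rpow_of_nonneg hb.le]
    _ ≤ _ := Finset.prod_le_prod' fun i _ =>
        ofReal_rumProb_rpow_mul_le hmeas hnonneg hint hlogconcave ha hb hab θ θ' (D i)

end LogConcave

/-- On a convex set of vectors with pairwise distinct coordinates, all vectors order the
coordinates in the same way. -/
lemma lt_of_convex_of_forall_ne {ι : Type*} {S : Set (ι → ℝ)} (hS : Convex ℝ S)
    (hne : ∀ θ ∈ S, ∀ j j', j ≠ j' → θ j ≠ θ j') {θ θ' : ι → ℝ} (hθ : θ ∈ S) (hθ' : θ' ∈ S)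
    {j j' : ι} (h : θ j' < θ j) : θ' j' < θ' j := by
  by_contra! hle
  have hjj : j ≠ j' := by rintro rfl; exact lt_irrefl _ h
  set p := θ j - θ j' with hp
  set q := θ' j' - θ' j with hq
  have hp0 : 0 < p := sub_pos.2 h
  have hq0 : 0 ≤ q := sub_nonneg.2 hle
  have hpq : p + q ≠ 0 := by positivity
  refine hne _ (hS hθ hθ' (a := q / (p + q)) (b := p / (p + q)) (by positivity) (by positivity)
    (by field_simp; ring)) j j' hjj ?_
  simp only [Pi.add_apply, Pi.smul_apply, smul_eq_mul]
  field_simp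
  rw [hp, hq]
  ring

/-- For a location-family RUM with log-concave densities, the set of global
maximizers of the log-likelihood on the hyperplane `θ_1 = 0` is convex; moreover,
if every maximizer has pairwise distinct coordinates, then all maximizers induce
the same strict order on the alternatives. -/
theorem stmt16 (m : ℕ) (hm : 1 ≤ m) (f : Fin m → ℝ → ℝ)
    (hmeas : ∀ j, Measurable (f j))
    (hnonneg : ∀ j x, 0 ≤ f j x)
    (hint : ∀ j, ∫ x, f j x = 1)
    (hlogconcave : ∀ j (x y lam : ℝ), 0 ≤ lam → lam ≤ 1 →
      f j x ^ lam * f j y ^ (1 - lam) ≤ f j (lam * x + (1 - lam) * y))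
    (n : ℕ) (D : Fin n → Equiv.Perm (Fin m)) :
    Convex ℝ (maxSet (by omega) f D) ∧
    ((∀ θ ∈ maxSet (by omega : 0 < m) f D, ∀ j j' : Fin m, j ≠ j' → θ j ≠ θ j') →
      ∀ θ ∈ maxSet (by omega : 0 < m) f D, ∀ θ' ∈ maxSet (by omega : 0 < m) f D,
        ∀ j j' : Fin m, θ j' < θ j ↔ θ' j' < θ' j) := by
  have hconv := convex_maxSet (by omega) hmeas hnonneg hint hlogconcave D
  exact ⟨hconv, fun hne θ hθ θ' hθ' j j' =>
    ⟨lt_of_convex_of_forall_ne hconv hne hθ hθ', lt_of_convex_of_forall_ne hconv hne hθ' hθ⟩⟩
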